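/- With d ≥ 10t², let W = span{(α_1)_σ ⊗ (α_2)_σ : σ ∈ S_t} and W' = span{(α_1)_σ ⊗ (α'_2)_σ : σ ∈ S_t} as subspaces of the matrix space ℂ^{(Dd)^t × (Dd)^t}. Then W and W' are everywhere close within 2√(t(t-1)/d): for every unit vector β in W there is β' ∈ W' with ‖β - β'‖₂ ≤ 2√(t(t-1)/d), and vice versa. -/

import Mathlib

open Matrix Kronecker

attribute [local instance] Matrix.frobeniusNormedAddCommGroup

/-- The unitary `Σ_σ` on `(ℂ^d)^{⊗t}` permuting the tensor factors according to
`σ ∈ S_t`, written as a matrix on the index set `Fin t → Fin d`. -/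
def permTensor (d t : ℕ) (σ : Equiv.Perm (Fin t)) :
    Matrix (Fin t → Fin d) (Fin t → Fin d) ℂ :=
  fun r c => if r = c ∘ σ.symm then 1 else 0

/-- The normalized permutation operator `α_σ = d^{-t/2} Σ_σ`. -/
noncomputable def alphaMat (d t : ℕ) (σ : Equiv.Perm (Fin t)) :
    Matrix (Fin t → Fin d) (Fin t → Fin d) ℂ :=
  ((Real.sqrt d : ℂ))⁻¹ ^ t • permTensor d t σ

/-- `α'_2`, the normalized projection onto distinct-index basis vectors. -/
noncomputable def alpha2' (d t : ℕ) : Matrix (Fin t → Fin d) (Fin t → Fin d) ℂ :=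
  fun r c => if r = c ∧ Function.Injective c then ((Real.sqrt d : ℂ))⁻¹ ^ t else 0

open Finset in
/-- Burnside-type count of the pairs `(z, π)` with `z` a word fixed by the permutation `π`. -/
theorem sum_card_perm_fixing (α : Type*) [Fintype α] [DecidableEq α] (t : ℕ) :
    ∑ z : Fin t → α, #{π : Equiv.Perm (Fin t) | z ∘ π = z} =
      ∏ i ∈ range t, (Fintype.card α + i) := by
  induction t with
  | zero => simp [Subsingleton.elim _ (default : Fin 0 → α)]
  | succ t ih =>
    have fix_iff (a : α) (w : Fin t → α) (p : Fin (t + 1)) (e : Equiv.Perm (Fin t)) :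
        (Fin.cons a w : Fin (t + 1) → α) ∘ Equiv.Perm.decomposeFin.symm (p, e) = Fin.cons a w ↔
          (Fin.cons a w : Fin (t + 1) → α) p = a ∧ w ∘ e = w := by
      constructor
      · intro h
        have h0 : (Fin.cons a w : Fin (t + 1) → α) p = a := by
          simpa using congrFun h 0
        refine ⟨h0, funext fun j => ?_⟩
        have hj := congrFun h j.succ
        simp only [Function.comp_apply, Equiv.Perm.decomposeFin_symm_apply_succ,
          Fin.cons_succ] at hj
        by_cases hp : (e j).succ = p
        · rw [hp, Equiv.swap_apply_right, Fin.cons_zero] at hj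
          rw [← hp, Fin.cons_succ] at h0
          simp [h0, hj]
        · rwa [Equiv.swap_apply_of_ne_of_ne (Fin.succ_ne_zero _) hp, Fin.cons_succ] at hj
      · rintro ⟨h0, h⟩
        funext i
        refine Fin.cases ?_ (fun j => ?_) i
        · simpa using h0
        · have hj := congrFun h j
          simp only [Function.comp_apply, Equiv.Perm.decomposeFin_symm_apply_succ,
            Fin.cons_succ] at hj ⊢
          by_cases hp : (e j).succ = p
          · rw [← hp, Fin.cons_succ] at h0
            rw [hp, Equiv.swap_apply_right, Fin.cons_zero, ← h0, hj]
          · rwa [Equiv.swap_apply_of_ne_of_ne (Fin.succ_ne_zero _) hp, Fin.cons_succ]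
    have card_fix (a : α) (w : Fin t → α) :
        #{π : Equiv.Perm (Fin (t + 1)) |
            (Fin.cons a w : Fin (t + 1) → α) ∘ π = Fin.cons a w} =
          (1 + ∑ j : Fin t, if w j = a then 1 else 0) *
            #{π : Equiv.Perm (Fin t) | w ∘ π = w} := by
      rw [card_filter, ← Equiv.sum_comp Equiv.Perm.decomposeFin.symm, Fintype.sum_prod_type]
      simp_rw [fix_iff, ite_and]
      rw [Fin.sum_univ_succ, card_filter, add_mul, sum_mul]
      simp
    rw [← (Fin.consEquiv fun _ : Fin (t + 1) => α).sum_comp, Fintype.sum_prod_type, sum_comm]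
    refine (sum_congr rfl fun w _ => sum_congr rfl fun a _ => card_fix a w).trans ?_
    have count (w : Fin t → α) :
        ∑ a : α, (1 + ∑ j : Fin t, if w j = a then 1 else 0) = Fintype.card α + t := by
      rw [sum_add_distrib, sum_comm]
      simp
    simp_rw [← sum_mul, count, ← mul_sum, ih, prod_range_succ, mul_comm]

open Finset in
/-- Pushing coefficients forward along `f` multiplies the squared `ℓ²` norm by at most the
largest fibre cardinality. -/
theorem sum_norm_sq_fiber_le {ι κ : Type*} [Fintype ι] [Fintype κ] [DecidableEq κ]
    (f : ι → κ) (c : ι → ℂ) (K : ℕ) (hK : ∀ k, #{i | k = f i} ≤ K) :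
    ∑ k, ‖∑ i, if k = f i then c i else 0‖ ^ 2 ≤ K * ∑ i, ‖c i‖ ^ 2 := by
  have hk (k : κ) : ‖∑ i, if k = f i then c i else 0‖ ^ 2 ≤
      K * ∑ i, if k = f i then ‖c i‖ ^ 2 else 0 := by
    rw [← sum_filter, ← sum_filter]
    calc ‖∑ i with k = f i, c i‖ ^ 2 ≤ (∑ i with k = f i, ‖c i‖) ^ 2 := by
          gcongr; exact norm_sum_le _ _
      _ ≤ #{i | k = f i} * ∑ i with k = f i, ‖c i‖ ^ 2 := sq_sum_le_card_mul_sum_sq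
      _ ≤ _ := by gcongr; exact hK k
  calc _ ≤ ∑ k, K * ∑ i, (if k = f i then ‖c i‖ ^ 2 else 0) := sum_le_sum fun k _ => hk k
    _ = _ := by rw [← mul_sum, sum_comm]; simp

open Finset in
theorem sum_norm_sq_fiber_of_injective {ι κ : Type*} [Fintype ι] [Fintype κ] [DecidableEq κ]
    (f : ι → κ) (hf : f.Injective) (c : ι → ℂ) :
    ∑ k, ‖∑ i, if k = f i then c i else 0‖ ^ 2 = ∑ i, ‖c i‖ ^ 2 := by
  have hk (k : κ) : ‖∑ i, if k = f i then c i else 0‖ ^ 2 =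
      ∑ i, if k = f i then ‖c i‖ ^ 2 else 0 := by
    by_cases h : ∃ j, k = f j
    · obtain ⟨j, rfl⟩ := h
      classical simp [hf.eq_iff]
    · push Not at h
      simp [h]
  simp_rw [hk]
  rw [sum_comm]
  simp

open Finset in
theorem one_sub_sum_le_prod_one_sub_range (a : ℕ → ℝ) (t : ℕ) (h0 : ∀ i < t, 0 ≤ a i)
    (h1 : ∀ i < t, a i ≤ 1) :
    1 - ∑ i ∈ range t, a i ≤ ∏ i ∈ range t, (1 - a i) ∧ ∏ i ∈ range t, (1 - a i) ≤ 1 := by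
  induction t with
  | zero => simp
  | succ t ih =>
    obtain ⟨hl, hu⟩ := ih (fun i hi => h0 i (by omega)) fun i hi => h1 i (by omega)
    have := h0 t (by omega)
    have := h1 t (by omega)
    have hp : 0 ≤ ∏ i ∈ range t, (1 - a i) :=
      prod_nonneg fun i hi => sub_nonneg.2 (h1 i (by have := mem_range.1 hi; omega))
    rw [sum_range_succ, prod_range_succ]
    constructor <;> nlinarith

open Finset in
/-- The rising factorial of `D * d` is close to `D ^ t` times the falling factorial of `d`. -/
theorem prod_add_le_mul_descFactorial (t d D : ℕ) (ht : 0 < t) (hd : 10 * t ^ 2 ≤ d)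
    (hD : 0 < D) :
    (∏ i ∈ range t, ((D : ℝ) * d + i)) ≤
      (1 + 4 * ((t : ℝ) * ((t : ℝ) - 1) / d)) * ((D : ℝ) ^ t * d.descFactorial t) := by
  have htd : t ≤ d := by nlinarith
  have hd0 : (0 : ℝ) < d := by exact_mod_cast ht.trans_le htd
  have hD1 : (1 : ℝ) ≤ D := by exact_mod_cast hD
  have ht1 : (1 : ℝ) ≤ t := by exact_mod_cast ht
  have hd' : 10 * (t : ℝ) ^ 2 ≤ d := by exact_mod_cast hd
  set u : ℝ := (t : ℝ) * ((t : ℝ) - 1) / d with hu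
  have hu0 : 0 ≤ u := div_nonneg (mul_nonneg (by linarith) (by linarith)) hd0.le
  have hu1 : u ≤ 1 / 10 := by
    rw [hu, div_le_iff₀ hd0]; nlinarith
  have hlt (i : ℕ) (hi : i < t) : (i : ℝ) / d ≤ 1 := by
    rw [div_le_one hd0]; exact_mod_cast (hi.le.trans htd)
  have hsum : ∑ i ∈ range t, (i : ℝ) / d = u / 2 := by
    rw [← sum_div, hu]
    have h : ((∑ i ∈ range t, i : ℕ) : ℝ) * 2 = t * ((t : ℝ) - 1) := by
      rw [← Nat.cast_ofNat, ← Nat.cast_mul, sum_range_id_mul_two, Nat.cast_mul, Nat.cast_pred ht]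
    push_cast at h
    rw [← h]; ring
  set P := ∏ i ∈ range t, (1 - (i : ℝ) / d) with hP
  set Q := ∏ i ∈ range t, (1 + (i : ℝ) / d) with hQ
  have hPl : 1 - u / 2 ≤ P := hsum ▸
    (one_sub_sum_le_prod_one_sub_range (fun i => (i : ℝ) / d) t (fun _ _ => by positivity) hlt).1
  have hQP : Q * P ≤ 1 := by
    rw [hP, hQ, ← prod_mul_distrib]
    refine prod_le_one (fun i hi => mul_nonneg (by positivity)
      (sub_nonneg.2 (hlt i (mem_range.1 hi)))) fun i _ => ?_
    nlinarith [sq_nonneg ((i : ℝ) / d)]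
  have hQle : Q ≤ (1 + 4 * u) * P := by
    have hP0 : 0 < P := by linarith
    have h2 : (1 - u / 2) ^ 2 ≤ P ^ 2 := by
      have : 0 ≤ 1 - u / 2 := by linarith
      gcongr
    have h3 : (1 : ℝ) ≤ (1 + 4 * u) * (1 - u / 2) ^ 2 := by nlinarith [pow_nonneg hu0 3]
    have h4 : (1 + 4 * u) * (1 - u / 2) ^ 2 ≤ (1 + 4 * u) * P ^ 2 := by gcongr
    refine le_of_mul_le_mul_right ?_ hP0
    nlinarith
  have hL : (∏ i ∈ range t, ((D : ℝ) * d + i)) ≤ ((D : ℝ) * d) ^ t * Q := by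
    rw [hQ, pow_eq_prod_const, ← prod_mul_distrib]
    refine prod_le_prod (fun i _ => by positivity) fun i _ => ?_
    rw [mul_add, mul_one, mul_assoc, mul_div_cancel₀ _ hd0.ne']
    have : (0 : ℝ) ≤ i := by positivity
    nlinarith
  have hR : (D : ℝ) ^ t * d.descFactorial t = ((D : ℝ) * d) ^ t * P := by
    rw [Nat.descFactorial_eq_prod_range, mul_pow, mul_assoc, Nat.cast_prod, hP]
    congr 1
    rw [pow_eq_prod_const, ← prod_mul_distrib]
    refine prod_congr rfl fun i hi => ?_
    rw [Nat.cast_sub ((mem_range.1 hi).le.trans htd)]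
    field_simp
  calc _ ≤ ((D : ℝ) * d) ^ t * Q := hL
    _ ≤ ((D : ℝ) * d) ^ t * ((1 + 4 * u) * P) := by gcongr
    _ = _ := by rw [hR]; ring

theorem frobenius_norm_sq {m n : Type*} [Fintype m] [Fintype n] (A : Matrix m n ℂ) :
    ‖A‖ ^ 2 = ∑ j, ∑ i, ‖A i j‖ ^ 2 := by
  rw [Matrix.frobenius_norm_def, ← Real.sqrt_eq_rpow, Real.sq_sqrt (by positivity),
    Finset.sum_comm]
  simp

/-- Simultaneous action of a permutation on a pair of words. -/
def permPair {D d t : ℕ} (z : (Fin t → Fin D) × (Fin t → Fin d)) (σ : Equiv.Perm (Fin t)) :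
    (Fin t → Fin D) × (Fin t → Fin d) :=
  (z.1 ∘ σ.symm, z.2 ∘ σ.symm)

theorem permPair_injective {D d t : ℕ} (z : (Fin t → Fin D) × (Fin t → Fin d))
    (hz : Function.Injective z.2) : Function.Injective (permPair z) := by
  intro σ τ h
  have h2 := congrArg Prod.snd h
  have : σ.symm = τ.symm := Equiv.ext fun i => hz (congrFun h2 i)
  simpa using congrArg Equiv.symm this

open Finset in
theorem card_permPair_fiber_le {D d t : ℕ} (z p : (Fin t → Fin D) × (Fin t → Fin d)) :
    #{σ | p = permPair z σ} ≤
      #{π : Equiv.Perm (Fin t) | (fun i => (z.1 i, z.2 i)) ∘ π = fun i => (z.1 i, z.2 i)} := by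
  obtain h | ⟨τ, hτ⟩ := ({σ | p = permPair z σ} : Finset _).eq_empty_or_nonempty
  · simp [h]
  rw [mem_filter] at hτ
  refine card_le_card_of_injOn (fun σ => σ⁻¹ * τ) (fun σ hσ => ?_) fun σ _ σ' _ h => by
    simpa using h
  simp only [coe_filter, mem_univ, true_and, Set.mem_ofPred_eq] at hσ ⊢
  have h := hσ.symm.trans hτ.2
  funext i
  have h1 := congrFun (congrArg Prod.fst h) (τ i)
  have h2 := congrFun (congrArg Prod.snd h) (τ i)
  simp only [permPair, Function.comp_apply, Equiv.symm_apply_apply] at h1 h2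
  simpa using ⟨h1, h2⟩

theorem sum_smul_kronecker_alphaMat_apply {D d t : ℕ} (c : Equiv.Perm (Fin t) → ℂ)
    (p z : (Fin t → Fin D) × (Fin t → Fin d)) :
    (∑ σ, c σ • (alphaMat D t σ ⊗ₖ alphaMat d t σ)) p z =
      ((Real.sqrt D : ℂ)⁻¹ ^ t * (Real.sqrt d : ℂ)⁻¹ ^ t) *
        ∑ σ, if p = permPair z σ then c σ else 0 := by
  rw [Matrix.sum_apply, Finset.mul_sum]
  refine Finset.sum_congr rfl fun σ _ => ?_
  simp only [Matrix.smul_apply, Matrix.kroneckerMap_apply, alphaMat, permTensor, smul_eq_mul,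
    permPair, Prod.ext_iff]
  by_cases h1 : p.1 = z.1 ∘ σ.symm <;> by_cases h2 : p.2 = z.2 ∘ σ.symm <;> simp [h1, h2]
  ring

theorem permTensor_mul_alpha2'_apply {d t : ℕ} (σ : Equiv.Perm (Fin t)) (r y : Fin t → Fin d)
    [Decidable (Function.Injective y)] :
    (permTensor d t σ * alpha2' d t) r y =
      if Function.Injective y then alphaMat d t σ r y else 0 := by
  rw [Matrix.mul_apply, Finset.sum_eq_single y]
  · by_cases hy : Function.Injective y <;> simp [alpha2', alphaMat, hy, mul_comm]
  · intro k _ hk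
    simp [alpha2', hk]
  · simp

theorem sum_smul_kronecker_alpha2'_apply {D d t : ℕ} (c : Equiv.Perm (Fin t) → ℂ)
    (p z : (Fin t → Fin D) × (Fin t → Fin d)) [Decidable (Function.Injective z.2)] :
    (∑ σ, c σ • (alphaMat D t σ ⊗ₖ (permTensor d t σ * alpha2' d t))) p z =
      if Function.Injective z.2 then
        (∑ σ, c σ • (alphaMat D t σ ⊗ₖ alphaMat d t σ)) p z else 0 := by
  simp only [Matrix.sum_apply, Matrix.smul_apply, Matrix.kroneckerMap_apply,
    permTensor_mul_alpha2'_apply]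
  split_ifs <;> simp

open Finset in
open scoped Classical in
theorem card_injective_snd (D d t : ℕ) :
    #{z : (Fin t → Fin D) × (Fin t → Fin d) | Function.Injective z.2} =
      D ^ t * d.descFactorial t := by
  have h : ({z : (Fin t → Fin D) × (Fin t → Fin d) | Function.Injective z.2} : Finset _) =
      univ ×ˢ ({y : Fin t → Fin d | Function.Injective y} : Finset _) := by
    ext; simp
  rw [h, card_product, card_univ, Fintype.card_pi_const, Fintype.card_fin,
    ← Fintype.card_subtype,
    Fintype.card_congr (Equiv.subtypeInjectiveEquivEmbedding (Fin t) (Fin d)),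
    Fintype.card_embedding_eq]
  simp

open Finset in
open scoped Classical in
/-- Projecting an element of the first span onto the columns with distinct second indices loses
little mass compared with what remains, and does not increase the norm. -/
theorem norm_sub_projection_le (t d D : ℕ) (ht : 0 < t) (hd : 10 * t ^ 2 ≤ d) (hD : 0 < D)
    (c : Equiv.Perm (Fin t) → ℂ) :
    let β := ∑ σ, c σ • (alphaMat D t σ ⊗ₖ alphaMat d t σ)
    let β' := ∑ σ, c σ • (alphaMat D t σ ⊗ₖ (permTensor d t σ * alpha2' d t))
    ‖β - β'‖ ≤ 2 * Real.sqrt ((t : ℝ) * ((t : ℝ) - 1) / d) * ‖β'‖ ∧ ‖β'‖ ≤ ‖β‖ := by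
  intro β β'
  have hβ' p z : β' p z = if Function.Injective z.2 then β p z else 0 :=
    sum_smul_kronecker_alpha2'_apply c p z
  constructor
  swap
  · refine (sq_le_sq₀ (norm_nonneg _) (norm_nonneg _)).1 ?_
    rw [frobenius_norm_sq, frobenius_norm_sq]
    refine sum_le_sum fun z _ => sum_le_sum fun p _ => ?_
    rw [hβ']
    split_ifs
    · exact le_rfl
    · simp
  have ht1 : (1 : ℝ) ≤ t := by exact_mod_cast ht
  have hu0 : 0 ≤ (t : ℝ) * ((t : ℝ) - 1) / d :=
    div_nonneg (mul_nonneg (by linarith) (by linarith)) (by positivity)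
  refine (sq_le_sq₀ (norm_nonneg _) (by positivity)).1 ?_
  rw [mul_pow, mul_pow, Real.sq_sqrt hu0, frobenius_norm_sq (β - β'), frobenius_norm_sq β']
  set u := (t : ℝ) * ((t : ℝ) - 1) / d
  set N : ℝ := ‖(Real.sqrt D : ℂ)⁻¹ ^ t * (Real.sqrt d : ℂ)⁻¹ ^ t‖ ^ 2
  set S : ℝ := ∑ σ, ‖c σ‖ ^ 2
  let F (z : (Fin t → Fin D) × (Fin t → Fin d)) : ℕ :=
    #{π : Equiv.Perm (Fin t) | (fun i => (z.1 i, z.2 i)) ∘ π = fun i => (z.1 i, z.2 i)}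
  have hS : 0 ≤ S := by positivity
  have hN : 0 ≤ N := by positivity
  have hcol z : ∑ p, ‖β p z‖ ^ 2 =
      N * ∑ p, ‖∑ σ, if p = permPair z σ then c σ else 0‖ ^ 2 := by
    rw [mul_sum]
    refine sum_congr rfl fun p _ => ?_
    rw [← mul_pow, ← norm_mul, ← sum_smul_kronecker_alphaMat_apply]
  have hproj z : ∑ p, ‖β' p z‖ ^ 2 = if Function.Injective z.2 then N * S else 0 := by
    simp_rw [hβ']
    split_ifs with hz
    · rw [hcol, sum_norm_sq_fiber_of_injective _ (permPair_injective z hz)]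
    · simp
  have hdiff z : ∑ p, ‖(β - β') p z‖ ^ 2 ≤
      N * S * (F z - if Function.Injective z.2 then 1 else 0) := by
    simp_rw [Matrix.sub_apply, hβ']
    split_ifs with hz
    · have hF : 1 ≤ F z := card_pos.2 ⟨1, by simp⟩
      have hF' : (1 : ℝ) ≤ F z := by exact_mod_cast hF
      simpa using mul_nonneg (mul_nonneg hN hS) (sub_nonneg.2 hF')
    · simp_rw [sub_zero]
      rw [hcol, mul_assoc, mul_comm S]
      gcongr
      exact sum_norm_sq_fiber_le _ c _ (card_permPair_fiber_le z)
  have hFsum : ∑ z, (F z : ℝ) = ∏ i ∈ range t, ((D : ℝ) * d + i) := by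
    have h := sum_card_perm_fixing (Fin D × Fin d) t
    rw [← (Equiv.arrowProdEquivProdArrow (Fin t) (fun _ => Fin D)
      (fun _ => Fin d)).symm.sum_comp] at h
    have h' := congrArg (Nat.cast : ℕ → ℝ) h
    push_cast [Fintype.card_prod, Fintype.card_fin] at h'
    rw [← h']
    refine sum_congr rfl fun z _ => ?_
    simp only [F]
    congr!
  have hinj : ∑ z : (Fin t → Fin D) × (Fin t → Fin d),
      (if Function.Injective z.2 then (1 : ℝ) else 0) = (D : ℝ) ^ t * d.descFactorial t := by
    rw [sum_boole, card_injective_snd]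
    push_cast
    rfl
  have hmain := prod_add_le_mul_descFactorial t d D ht hd hD
  calc _ ≤ ∑ z, N * S * (F z - if Function.Injective z.2 then 1 else 0) :=
        sum_le_sum fun z _ => hdiff z
    _ = N * S * (∏ i ∈ range t, ((D : ℝ) * d + i) - (D : ℝ) ^ t * d.descFactorial t) := by
        rw [← mul_sum, sum_sub_distrib, hFsum, hinj]
    _ ≤ N * S * (4 * u * ((D : ℝ) ^ t * d.descFactorial t)) := by
        gcongr
        linarith
    _ = 2 ^ 2 * u * ∑ z, ∑ p, ‖β' p z‖ ^ 2 := by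
        simp_rw [hproj, ← hinj, mul_sum]
        refine sum_congr rfl fun z _ => ?_
        split_ifs <;> ring

/-- With `d ≥ 10t²` and `D ≥ d`, the subspaces
`W = span{(α₁)_σ ⊗ (α₂)_σ}` and `W' = span{(α₁)_σ ⊗ (α'₂)_σ}` of the matrix
space are everywhere close within `2√(t(t-1)/d)`: every unit vector of either
subspace is within Hilbert-Schmidt distance `2√(t(t-1)/d)` of the other. -/
theorem stmt_12 (t d D : ℕ) (ht : 0 < t) (hd : 10 * t ^ 2 ≤ d) (hD : d ≤ D) :
    let W := Submodule.span ℂ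
      (Set.range fun σ : Equiv.Perm (Fin t) => alphaMat D t σ ⊗ₖ alphaMat d t σ)
    let W' := Submodule.span ℂ
      (Set.range fun σ : Equiv.Perm (Fin t) =>
        alphaMat D t σ ⊗ₖ (permTensor d t σ * alpha2' d t))
    (∀ β ∈ W, ‖β‖ = 1 →
      ∃ β' ∈ W', ‖β - β'‖ ≤ 2 * Real.sqrt ((t : ℝ) * ((t : ℝ) - 1) / d)) ∧
    (∀ β' ∈ W', ‖β'‖ = 1 →
      ∃ β ∈ W, ‖β' - β‖ ≤ 2 * Real.sqrt ((t : ℝ) * ((t : ℝ) - 1) / d)) := by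
  intro W W'
  have hD0 : 0 < D := by nlinarith
  constructor
  · intro β hβ hnorm
    obtain ⟨c, rfl⟩ := (Submodule.mem_span_range_iff_exists_fun ℂ).1 hβ
    obtain ⟨h, hle⟩ := norm_sub_projection_le t d D ht hd hD0 c
    refine ⟨_, (Submodule.mem_span_range_iff_exists_fun ℂ).2 ⟨c, rfl⟩, h.trans ?_⟩
    exact mul_le_of_le_one_right (by positivity) (hle.trans_eq hnorm)
  · intro β' hβ' hnorm
    obtain ⟨c, rfl⟩ := (Submodule.mem_span_range_iff_exists_fun ℂ).1 hβ'
    obtain ⟨h, -⟩ := norm_sub_projection_le t d D ht hd hD0 c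
    refine ⟨_, (Submodule.mem_span_range_iff_exists_fun ℂ).2 ⟨c, rfl⟩, ?_⟩
    rw [norm_sub_rev]
    exact h.trans_eq (by rw [hnorm, mul_one])
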